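/- Generation for variables: if x^L : ⟨Γ ⊢ U⟩ in the indexed intersection type system with expansion variables, then Γ = (x^L : V) for some type V with V ⊑ U. -/

import Mathlib

/-! # The indexed λ-calculus with expansion variables
(Kamareddine, Nour, Rahli, Wells) -/

/-- Indexed variables: a variable name together with an index
(a finite sequence of natural numbers). -/
abbrev IVar := ℕ × List ℕ

/-- Raw terms of the indexed λ-calculus. -/
inductive Trm : Type
  | var : ℕ → List ℕ → Trm
  | app : Trm → Trm → Trm
  | lam : ℕ → List ℕ → Trm → Trm
  deriving DecidableEq

namespace Trm

/-- Free (indexed) variables of a term. -/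
def fv : Trm → Finset IVar
  | var x L => {(x, L)}
  | app M N => fv M ∪ fv N
  | lam x L M => fv M \ {(x, L)}

/-- Degree of a term. -/
def deg : Trm → List ℕ
  | var _ L => L
  | app M _ => deg M
  | lam _ _ M => deg M

/-- `M ◇ N` : the terms `M` and `N` are joinable. -/
def Joinable (M N : Trm) : Prop :=
  ∀ x L K, (x, L) ∈ fv M → (x, K) ∈ fv N → L = K

/-- Well-formed terms (membership in the set 𝓜). -/
inductive Wf : Trm → Prop
  | var (x : ℕ) (L : List ℕ) : Wf (var x L)
  | app {M N : Trm} : Wf M → Wf N → deg M <+: deg N → Joinable M N → Wf (app M N)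
  | lam {M : Trm} (x : ℕ) (L : List ℕ) : Wf M → deg M <+: L → Wf (lam x L M)

/-- Substitution `M[x^L := N]`. -/
def subst (M : Trm) (x : ℕ) (L : List ℕ) (N : Trm) : Trm :=
  match M with
  | var y K => if (y, K) = (x, L) then N else var y K
  | app P Q => app (subst P x L N) (subst Q x L N)
  | lam y K P => if (y, K) = (x, L) then lam y K P else lam y K (subst P x L N)

/-- Simultaneous substitution `M[(x_j^{L_j} := N_j)_n]`. -/
def msubst : List (IVar × Trm) → Trm → Trm
  | σ, var y K =>
      match σ.find? (fun e => decide (e.1 = (y, K))) with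
      | some e => e.2
      | none => var y K
  | σ, app M N => app (msubst σ M) (msubst σ N)
  | σ, lam y K M => lam y K (msubst (σ.filter fun e => decide (e.1 ≠ (y, K))) M)

/-- `M^{+i}` : prepend `i` to every index occurring in `M`. -/
def lift (i : ℕ) : Trm → Trm
  | var x L => var x (i :: L)
  | app M N => app (lift i M) (lift i N)
  | lam x L M => lam x (i :: L) (lift i M)

/-- One step of `M^{-i}` (meaningful when every index of `M` starts with `i`). -/
def lower : Trm → Trm
  | var x L => var x L.tail
  | app M N => app (lower M) (lower N)
  | lam x L M => lam x L.tail (lower M)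

/-- `M^{-K}`. -/
def lowerSeq (K : List ℕ) (M : Trm) : Trm := K.foldl (fun M _ => lower M) M

end Trm

open Trm

/-- Base β-redexes. -/
inductive BetaBase : Trm → Trm → Prop
  | redex {x : ℕ} {L : List ℕ} {M N : Trm} :
      Wf (.app (.lam x L M) N) → deg N = L →
      BetaBase (.app (.lam x L M) N) (Trm.subst M x L N)

/-- Base η-redexes. -/
inductive EtaBase : Trm → Trm → Prop
  | redex {x : ℕ} {L : List ℕ} {M : Trm} :
      Wf (.lam x L (.app M (.var x L))) → (x, L) ∉ fv M →
      EtaBase (.lam x L (.app M (.var x L))) M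

/-- Compatible closure of a relation, on well-formed terms. -/
inductive Compat (R : Trm → Trm → Prop) : Trm → Trm → Prop
  | base {M N : Trm} : R M N → Compat R M N
  | lam {x : ℕ} {L : List ℕ} {M N : Trm} :
      Compat R M N → Wf (.lam x L M) → Wf (.lam x L N) →
      Compat R (.lam x L M) (.lam x L N)
  | appL {M N P : Trm} :
      Compat R M N → Wf (.app M P) → Wf (.app N P) →
      Compat R (.app M P) (.app N P)
  | appR {M N P : Trm} :
      Compat R M N → Wf (.app P M) → Wf (.app P N) →
      Compat R (.app P M) (.app P N)

/-- One-step β-reduction `▷_β`. -/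
def BetaRed : Trm → Trm → Prop := Compat BetaBase

/-- One-step η-reduction `▷_η`. -/
def EtaRed : Trm → Trm → Prop := Compat EtaBase

/-- One-step βη-reduction `▷_βη = ▷_β ∪ ▷_η`. -/
def BetaEtaRed (M N : Trm) : Prop := BetaRed M N ∨ EtaRed M N

/-- Weak head reduction `▷_h`. -/
inductive HRed : Trm → Trm → Prop
  | head {x : ℕ} {L : List ℕ} {M N : Trm} :
      Wf (.app (.lam x L M) N) → deg N = L →
      HRed (.app (.lam x L M) N) (Trm.subst M x L N)
  | app {M M' P : Trm} :
      HRed M M' → Wf (.app M P) → Wf (.app M' P) →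
      HRed (.app M P) (.app M' P)

/-- `▷*_r` : reflexive transitive closure of a reduction. -/
def RedStar (R : Trm → Trm → Prop) : Trm → Trm → Prop := Relation.ReflTransGen R

/-- `≃_r` : the equivalence relation induced by `▷*_r`. -/
inductive RedConv (R : Trm → Trm → Prop) : Trm → Trm → Prop
  | rel {M N : Trm} : RedStar R M N → RedConv R M N
  | symm {M N : Trm} : RedConv R M N → RedConv R N M
  | trans {M N P : Trm} : RedConv R M N → RedConv R N P → RedConv R M P

/-- `r ∈ {β, βη, h}`. -/
def IsRed (R : Trm → Trm → Prop) : Prop :=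
  R = BetaRed ∨ R = BetaEtaRed ∨ R = HRed

/-! ## Types -/

/-- Raw types. -/
inductive PreTy : Type
  | atom : ℕ → PreTy
  | arrow : PreTy → PreTy → PreTy
  | omega : List ℕ → PreTy
  | inter : PreTy → PreTy → PreTy
  | exp : ℕ → PreTy → PreTy
  deriving DecidableEq

/-- Degree of a type. -/
def tdeg : PreTy → List ℕ
  | .atom _ => []
  | .arrow _ _ => []
  | .omega L => L
  | .inter U _ => tdeg U
  | .exp i U => i :: tdeg U

mutual
  /-- The set 𝕋 of types. -/
  inductive TyT : PreTy → Prop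
    | atom (a : ℕ) : TyT (.atom a)
    | arrow {U T : PreTy} : TyU U → TyT T → TyT (.arrow U T)
  /-- The set 𝕌 of types. -/
  inductive TyU : PreTy → Prop
    | ofT {T : PreTy} : TyT T → TyU T
    | omega (L : List ℕ) : TyU (.omega L)
    | inter {U V : PreTy} : TyU U → TyU V → tdeg U = tdeg V → TyU (.inter U V)
    | exp (i : ℕ) {U : PreTy} : TyU U → TyU (.exp i U)
end

/-- Equality of types modulo the identifications of the paper
(⊓ commutative, associative, idempotent; expansion variables distribute
over ⊓; ω neutral; ē_i ω^K = ω^{i::K}). -/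
inductive TyEq : PreTy → PreTy → Prop
  | refl (U : PreTy) : TyEq U U
  | symm {U V : PreTy} : TyEq U V → TyEq V U
  | trans {U V W : PreTy} : TyEq U V → TyEq V W → TyEq U W
  | arrowCongr {U U' T T' : PreTy} :
      TyEq U U' → TyEq T T' → TyEq (.arrow U T) (.arrow U' T')
  | interCongr {U U' V V' : PreTy} :
      TyEq U U' → TyEq V V' → TyEq (.inter U V) (.inter U' V')
  | expCongr (i : ℕ) {U U' : PreTy} : TyEq U U' → TyEq (.exp i U) (.exp i U')
  | interComm (U V : PreTy) : TyEq (.inter U V) (.inter V U)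
  | interAssoc (U V W : PreTy) :
      TyEq (.inter U (.inter V W)) (.inter (.inter U V) W)
  | interIdem (U : PreTy) : TyEq (.inter U U) U
  | expDist (i : ℕ) (U V : PreTy) :
      TyEq (.exp i (.inter U V)) (.inter (.exp i U) (.exp i V))
  | omegaNeutral {L : List ℕ} {U : PreTy} :
      tdeg U = L → TyEq (.inter (.omega L) U) U
  | expOmega (i : ℕ) (K : List ℕ) : TyEq (.exp i (.omega K)) (.omega (i :: K))

/-- `e⃗_K U`. -/
def expSeq : List ℕ → PreTy → PreTy
  | [], U => U
  | i :: K, U => .exp i (expSeq K U)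

/-- Intersection of a list of types (meaningful for nonempty lists). -/
def interAll : List PreTy → PreTy
  | [] => .omega []
  | T :: Ts => Ts.foldl PreTy.inter T

/-- One step of `U^{-i}` (meaningful when `tdeg U` starts with `i`). -/
def tlower : PreTy → PreTy
  | .exp _ U => U
  | .inter U V => .inter (tlower U) (tlower V)
  | .omega L => .omega L.tail
  | U => U

/-- `U^{-K}`. -/
def tlowerSeq (K : List ℕ) (U : PreTy) : PreTy := K.foldl (fun U _ => tlower U) U

/-- Subtyping `⊑` on types (reflexivity holds up to the identifications `TyEq`). -/
inductive TySub : PreTy → PreTy → Prop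
  | ofEq {U V : PreTy} : TyEq U V → TySub U V
  | trans {U V W : PreTy} : TySub U V → TySub V W → TySub U W
  | interLeft {U V : PreTy} : tdeg U = tdeg V → TySub (.inter U V) U
  | inter {U₁ U₂ V₁ V₂ : PreTy} :
      TySub U₁ V₁ → TySub U₂ V₂ → TySub (.inter U₁ U₂) (.inter V₁ V₂)
  | arrow {U₁ U₂ T₁ T₂ : PreTy} :
      TySub U₂ U₁ → TySub T₁ T₂ → TySub (.arrow U₁ T₁) (.arrow U₂ T₂)
  | exp (i : ℕ) {U V : PreTy} : TySub U V → TySub (.exp i U) (.exp i V)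

/-! ## Type environments -/

/-- Type environments: finite-ish assignments of types to indexed variables. -/
def TyEnv : Type := IVar → Option PreTy

namespace TyEnv

/-- The empty environment `()`. -/
def empty : TyEnv := fun _ => none

/-- Singleton environment `(x^L : U)`. -/
def single (v : IVar) (U : PreTy) : TyEnv := fun w => if w = v then some U else none

/-- `Γ, (x^L : U)`. -/
def extend (Γ : TyEnv) (v : IVar) (U : PreTy) : TyEnv :=
  fun w => if w = v then some U else Γ w

/-- `Γ₁ ⊓ Γ₂`. -/
def inter (Γ₁ Γ₂ : TyEnv) : TyEnv := fun v =>
  match Γ₁ v, Γ₂ v with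
  | some U, some V => some (PreTy.inter U V)
  | some U, none => some U
  | none, o => o

/-- `ē_j Γ`. -/
def expand (j : ℕ) (Γ : TyEnv) : TyEnv := fun v =>
  match v.2 with
  | [] => none
  | i :: L => if i = j then (Γ (v.1, L)).map (PreTy.exp j) else none

/-- `env^ω_M`. -/
def omegaOf (M : Trm) : TyEnv :=
  fun v => if v ∈ Trm.fv M then some (PreTy.omega v.2) else none

/-- `Γ` is OK: `d(U) = L` for every `x^L : U ∈ Γ`. -/
def OK (Γ : TyEnv) : Prop := ∀ x L U, Γ (x, L) = some U → tdeg U = L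

/-- `Γ₁ ◇ Γ₂`. -/
def Diamond (Γ₁ Γ₂ : TyEnv) : Prop :=
  ∀ x L K, Γ₁ (x, L) ≠ none → Γ₂ (x, K) ≠ none → L = K

/-- `Γ ⊑ Γ'` : same domain and pointwise subtyping. -/
def Sub (Γ Γ' : TyEnv) : Prop :=
  (∀ v, Γ v = none ↔ Γ' v = none) ∧
  ∀ v U U', Γ v = some U → Γ' v = some U' → TySub U U'

/-- `d(Γ) ⪰ L`. -/
def DegGe (Γ : TyEnv) (L : List ℕ) : Prop :=
  ∀ x K U, Γ (x, K) = some U → L <+: tdeg U ∧ L <+: K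

/-- One step of `Γ^{-i}`. -/
def lower (i : ℕ) (Γ : TyEnv) : TyEnv := fun v => (Γ (v.1, i :: v.2)).map tlower

/-- `Γ^{-K}`. -/
def lowerSeq (K : List ℕ) (Γ : TyEnv) : TyEnv :=
  K.foldl (fun Γ i => lower i Γ) Γ

/-- `Γ↾_S` : restriction of `Γ` to the variables in `S`. -/
def restrict (Γ : TyEnv) (S : Finset IVar) : TyEnv :=
  fun v => if v ∈ S then Γ v else none

/-- `Γ↑^S` : extend `Γ` by `ω`-types on the variables of `S` not in `dom Γ`. -/
def up (Γ : TyEnv) (S : Finset IVar) : TyEnv := fun v =>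
  match Γ v with
  | some U => some U
  | none => if v ∈ S then some (PreTy.omega v.2) else none

end TyEnv

/-! ## The typing relation -/

/-- The typing relation `M : ⟨Γ ⊢ U⟩`. -/
inductive Typ : Trm → TyEnv → PreTy → Prop
  | ax {x : ℕ} {T : PreTy} :
      TyT T → Typ (.var x []) (TyEnv.single (x, []) T) T
  | omegaI {M : Trm} :
      Wf M → Typ M (TyEnv.omegaOf M) (.omega (Trm.deg M))
  | arrI {M : Trm} {Γ : TyEnv} {x : ℕ} {L : List ℕ} {U T : PreTy} :
      Γ (x, L) = none → TyU U → TyT T →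
      Typ M (Γ.extend (x, L) U) T →
      Typ (.lam x L M) Γ (.arrow U T)
  | arrI' {M : Trm} {Γ : TyEnv} {x : ℕ} {L : List ℕ} {T : PreTy} :
      Γ (x, L) = none → TyT T →
      Typ M Γ T →
      Typ (.lam x L M) Γ (.arrow (.omega L) T)
  | arrE {M₁ M₂ : Trm} {Γ₁ Γ₂ : TyEnv} {U T : PreTy} :
      TyU U → TyT T →
      Typ M₁ Γ₁ (.arrow U T) → Typ M₂ Γ₂ U → TyEnv.Diamond Γ₁ Γ₂ →
      Typ (.app M₁ M₂) (Γ₁.inter Γ₂) T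
  | interI {M : Trm} {Γ : TyEnv} {U₁ U₂ : PreTy} :
      Typ M Γ U₁ → Typ M Γ U₂ → Typ M Γ (.inter U₁ U₂)
  | expI {M : Trm} {Γ : TyEnv} {U : PreTy} (j : ℕ) :
      Typ M Γ U → Typ (Trm.lift j M) (TyEnv.expand j Γ) (.exp j U)
  | sub {M : Trm} {Γ Γ' : TyEnv} {U U' : PreTy} :
      Typ M Γ U → TyEnv.Sub Γ' Γ → TySub U U' → Typ M Γ' U'

/-! ## Realisability semantics -/

/-- `X^{+i}`. -/
def liftSet (i : ℕ) (X : Set Trm) : Set Trm := Trm.lift i '' X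

/-- `X ⇝ Y`. -/
def arrowSet (X Y : Set Trm) : Set Trm :=
  {M | ∀ N ∈ X, Joinable M N → Trm.app M N ∈ Y}

/-- `X` is `r`-saturated. -/
def RSaturated (R : Trm → Trm → Prop) (X : Set Trm) : Prop :=
  ∀ M N, RedStar R M N → N ∈ X → M ∈ X

/-- `𝓜^L` : well-formed terms of degree `L`. -/
def TrmDeg (L : List ℕ) : Set Trm := {M | Wf M ∧ Trm.deg M = L}

/-- The set of variables `𝓥₁` (its complement is `𝓥₂`). -/
def V1 : Set ℕ := {n | Even n}

/-- Spines `x^L N₁ … N_k`. -/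
inductive Spine (x : ℕ) (L : List ℕ) : Trm → Prop
  | var : Spine x L (.var x L)
  | app {M N : Trm} : Spine x L M → Spine x L (.app M N)

/-- `𝓝_x^L`. -/
def Nx (x : ℕ) (L : List ℕ) : Set Trm := {M | Wf M ∧ Spine x L M}

/-- `I` is an `r`-interpretation. -/
structure IsInterp (R : Trm → Trm → Prop) (I : ℕ → Set Trm) : Prop where
  sat : ∀ a, RSaturated R (I a)
  sub : ∀ a, I a ⊆ TrmDeg []
  nx : ∀ a, ∀ x ∈ V1, Nx x [] ⊆ I a

/-- Extension of an interpretation to all types. -/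
def interp (I : ℕ → Set Trm) : PreTy → Set Trm
  | .atom a => I a
  | .omega L => TrmDeg L
  | .inter U V => interp I U ∩ interp I V
  | .exp i U => liftSet i (interp I U)
  | .arrow U T => arrowSet (interp I U) (interp I T)

/-- `[U]_r` : the meaning of the type `U`. -/
def Sem (R : Trm → Trm → Prop) (U : PreTy) : Set Trm :=
  {M | Wf M ∧ Trm.fv M = ∅ ∧ ∀ I, IsInterp R I → M ∈ interp I U}

theorem TySub.refl (U : PreTy) : TySub U U := .ofEq (.refl U)

/-- `U₁ ⊓ U₂` is a greatest lower bound: the introduction half. -/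
theorem TySub.le_inter {V U₁ U₂ : PreTy} (h₁ : TySub V U₁) (h₂ : TySub V U₂) :
    TySub V (.inter U₁ U₂) :=
  .trans (.ofEq (.symm (.interIdem V))) (.inter h₁ h₂)

namespace TyEnv

@[simp]
theorem single_self (v : IVar) (U : PreTy) : single v U v = some U := by
  simp [single]

theorem single_of_ne {v w : IVar} (h : w ≠ v) (U : PreTy) : single v U w = none := by
  simp [single, h]

theorem single_inj {v : IVar} {U V : PreTy} (h : single v U = single v V) : U = V := by
  simpa using congrFun h v

theorem omegaOf_var (x : ℕ) (L : List ℕ) :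
    omegaOf (.var x L) = single (x, L) (.omega L) := by
  funext w
  by_cases h : w = (x, L) <;> simp [omegaOf, single, Trm.fv, h]

theorem expand_single (j x : ℕ) (L : List ℕ) (U : PreTy) :
    expand j (single (x, L) U) = single (x, j :: L) (.exp j U) := by
  funext ⟨y, K⟩
  cases K with
  | nil => simp [expand, single]
  | cons i K =>
    by_cases hi : i = j
    · by_cases h : y = x ∧ K = L <;> simp [expand, single, hi, h]
    · simp [expand, single, hi]

/-- An environment below a singleton environment is a singleton. -/
theorem Sub.eq_single {Γ : TyEnv} {v : IVar} {U : PreTy} (h : Sub Γ (single v U)) :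
    ∃ V, Γ = single v V ∧ TySub V U := by
  obtain ⟨hdom, hsub⟩ := h
  cases hv : Γ v with
  | none => simp [hdom v] at hv
  | some V =>
    refine ⟨V, funext fun w => ?_, hsub v V U hv (single_self v U)⟩
    by_cases hw : w = v
    · simp [hw, hv]
    · rw [single_of_ne hw, hdom, single_of_ne hw]

end TyEnv

/-- generation for variables. -/
theorem stmt8 (x : ℕ) (L : List ℕ) (Γ : TyEnv) (U : PreTy)
    (h : Typ (.var x L) Γ U) :
    ∃ V : PreTy, Γ = TyEnv.single (x, L) V ∧ TySub V U := by
  generalize hM : Trm.var x L = M at h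
  induction h generalizing L with
  | ax _ =>
    cases hM
    exact ⟨_, rfl, .refl _⟩
  | omegaI _ =>
    subst hM
    exact ⟨_, TyEnv.omegaOf_var x L, .refl _⟩
  | arrI => cases hM
  | arrI' => cases hM
  | arrE => cases hM
  | interI _ _ ih₁ ih₂ =>
    obtain ⟨V, hV, h₁⟩ := ih₁ L hM
    obtain ⟨W, hW, h₂⟩ := ih₂ L hM
    obtain rfl := TyEnv.single_inj (hV.symm.trans hW)
    exact ⟨V, hV, h₁.le_inter h₂⟩
  | @expI M _ _ j _ ih =>
    cases M with
    | var y K =>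
      cases hM
      obtain ⟨V, rfl, hV⟩ := ih K rfl
      exact ⟨.exp j V, TyEnv.expand_single j x K V, hV.exp j⟩
    | app _ _ => cases hM
    | lam _ _ _ => cases hM
  | sub _ hΓ hU ih =>
    obtain ⟨V, rfl, hV⟩ := ih L hM
    obtain ⟨W, hW, hWV⟩ := hΓ.eq_single
    exact ⟨W, hW, hWV.trans (hV.trans hU)⟩
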